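/- Let X be a solution of the perturbed ODE. If the perturbation parameters satisfy 0 ≤ (√μ/2)Δ₂ ≤ Δ₁, then for all t ≥ 0, f(X_t) − f(x*) ≤ (1/(1+Δ₁))·e^{−√μ t}·E(0). -/

import Mathlib

open scoped InnerProductSpace in
/-- First-order lower bound for a differentiable strongly convex function. -/
theorem StrongConvexOn.sub_le_inner_gradient
    {H : Type*} [NormedAddCommGroup H] [InnerProductSpace ℝ H] [CompleteSpace H]
    {f : H → ℝ} {μ : ℝ} (hsc : StrongConvexOn Set.univ μ f) {x : H}
    (hf : DifferentiableAt ℝ f x) (y : H) :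
    f x - f y ≤ ⟪gradient f x, x - y⟫_ℝ - μ / 2 * ‖x - y‖ ^ 2 := by
  have hconv : ConvexOn ℝ Set.univ
      (fun a : ℝ => f (x + a • (y - x)) - μ / 2 * ‖x + a • (y - x)‖ ^ 2) := by
    have h := (strongConvexOn_iff_convex.1 hsc).comp_affineMap (AffineMap.lineMap (k := ℝ) x y)
    simpa [Function.comp_def, AffineMap.lineMap_apply, add_comm] using h
  have hline : HasDerivAt (fun a : ℝ => x + a • (y - x)) (y - x) 0 := by
    simpa using ((hasDerivAt_id (0 : ℝ)).smul_const (y - x)).const_add x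
  have hfx : HasDerivAt (fun a : ℝ => f (x + a • (y - x))) ⟪gradient f x, y - x⟫_ℝ 0 := by
    have h : HasFDerivAt f (InnerProductSpace.toDual ℝ H (gradient f x))
        (x + (0 : ℝ) • (y - x)) := by
      simpa using hf.hasGradientAt.hasFDerivAt
    exact h.comp_hasDerivAt (0 : ℝ) hline
  have hderiv := hfx.sub (hline.norm_sq.const_mul (μ / 2))
  have hslope := hconv.le_slope_of_hasDerivAt (Set.mem_univ 0) (Set.mem_univ 1) zero_lt_one hderiv
  have hy : ‖y‖ ^ 2 = ‖x‖ ^ 2 + 2 * ⟪x, y - x⟫_ℝ + ‖x - y‖ ^ 2 := by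
    rw [norm_sub_rev x y, ← norm_add_sq_real, add_sub_cancel]
  have hinner : ⟪gradient f x, y - x⟫_ℝ = -⟪gradient f x, x - y⟫_ℝ := by
    rw [← inner_neg_right, neg_sub]
  simp only [slope_def_field, zero_smul, add_zero, one_smul, add_sub_cancel, sub_zero,
    div_one, hy, hinner] at hslope
  linarith

open scoped InnerProductSpace in
/-- The dissipation inequality behind the decay of the Lyapunov function. -/
theorem lyapunov_dissipation_nonpos
    {H : Type*} [NormedAddCommGroup H] [InnerProductSpace ℝ H]
    {s Δ₁ Δ₂ d : ℝ} (hs : 0 ≤ s) (hΔ₁ : 0 ≤ Δ₁) (hΔ₂ : 0 ≤ Δ₂) (hcond : s / 2 * Δ₂ ≤ Δ₁)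
    (v g y : H) (hd : d ≤ ⟪g, y⟫_ℝ - s ^ 2 / 2 * ‖y‖ ^ 2) :
    s * ((1 + Δ₁) * d + 1 / 2 * ‖v + s • y + Δ₂ • g‖ ^ 2) +
      ((1 + Δ₁) * ⟪g, v⟫_ℝ +
        ⟪v + s • y + Δ₂ • g, -(s • v) - (1 + Δ₁) • g⟫_ℝ) ≤ 0 := by
  have hd' := mul_le_mul_of_nonneg_left hd (mul_nonneg hs (by linarith : 0 ≤ 1 + Δ₁))
  have hsq := mul_nonneg hΔ₂ (sq_nonneg ‖g - (s ^ 2 / 2) • y‖)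
  have hg := mul_le_mul_of_nonneg_right hcond (mul_nonneg hΔ₂ (sq_nonneg ‖g‖))
  have hy := mul_le_mul_of_nonneg_right hcond
    (mul_nonneg (pow_nonneg hs 3) (sq_nonneg ‖y‖))
  have hv := mul_nonneg hs (sq_nonneg ‖v‖)
  simp only [← real_inner_self_eq_norm_sq, inner_add_left, inner_add_right, inner_sub_left,
    inner_sub_right, inner_neg_right, real_inner_smul_left, real_inner_smul_right,
    real_inner_comm v g, real_inner_comm v y, real_inner_comm g y] at *
  linarith

/-- convergence rate of the function values along the perturbed ODE
under the condition `0 ≤ (√μ/2)Δ₂ ≤ Δ₁`. -/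
theorem perturbed_ode_function_value_rate
    {H : Type*} [NormedAddCommGroup H] [InnerProductSpace ℝ H] [FiniteDimensional ℝ H]
    (f : H → ℝ) (μ : ℝ) (hμ : 0 < μ)
    (hf : ContDiff ℝ 2 f) (hsc : StrongConvexOn Set.univ μ f)
    (xs : H) (hmin : ∀ y, f xs ≤ f y)
    (Δ₁ Δ₂ : ℝ) (hΔ₁ : 0 ≤ Δ₁) (hΔ₂ : 0 ≤ Δ₂)
    (hcond : Real.sqrt μ / 2 * Δ₂ ≤ Δ₁)
    (X V G : ℝ → H)
    (hX : ∀ t, HasDerivAt X (V t) t)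
    (hG : ∀ t, HasDerivAt (fun τ => gradient f (X τ)) (G t) t)
    (hV : ∀ t, HasDerivAt V
      (-((2 * Real.sqrt μ) • V t) - (1 + Δ₁) • gradient f (X t) - Δ₂ • G t) t)
    (E : ℝ → ℝ)
    (hE : ∀ t, E t = Real.exp (Real.sqrt μ * t) *
      ((1 + Δ₁) * (f (X t) - f xs) +
        (1 / 2) * ‖V t + Real.sqrt μ • (X t - xs) + Δ₂ • gradient f (X t)‖ ^ 2)) :
    ∀ t, 0 ≤ t →
      f (X t) - f xs ≤ 1 / (1 + Δ₁) * Real.exp (-(Real.sqrt μ * t)) * E 0 := by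
  set s := Real.sqrt μ with hs
  have hs0 : 0 ≤ s := Real.sqrt_nonneg μ
  have hs2 : s ^ 2 = μ := Real.sq_sqrt hμ.le
  have hdiff : Differentiable ℝ f := hf.differentiable (by norm_num)
  have hfX : ∀ t, HasDerivAt (fun τ => f (X τ)) (inner ℝ (gradient f (X t)) (V t)) t := by
    intro t
    exact (hdiff (X t)).hasGradientAt.hasFDerivAt.comp_hasDerivAt t (hX t)
  have hW : ∀ t, HasDerivAt (fun τ => V τ + s • (X τ - xs) + Δ₂ • gradient f (X τ))
      (-(s • V t) - (1 + Δ₁) • gradient f (X t)) t := by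
    intro t
    refine (((hV t).add (((hX t).sub_const xs).const_smul s)).add
      ((hG t).const_smul Δ₂)).congr_deriv ?_
    module
  have hexp : ∀ t, HasDerivAt (fun τ => Real.exp (s * τ)) (Real.exp (s * t) * s) t := by
    intro t
    simpa using ((hasDerivAt_id t).const_mul s).exp
  have hanti : Antitone E := by
    rw [funext hE]
    refine antitone_of_hasDerivAt_nonpos
      (fun t => (hexp t).mul ((((hfX t).sub_const (f xs)).const_mul (1 + Δ₁)).add
        ((hW t).norm_sq.const_mul (1 / 2)))) (fun t => ?_)
    have hd := hsc.sub_le_inner_gradient (hdiff (X t)) xs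
    rw [← hs2] at hd
    have h := mul_nonpos_of_nonneg_of_nonpos (Real.exp_nonneg (s * t))
      (lyapunov_dissipation_nonpos hs0 hΔ₁ hΔ₂ hcond (V t) _ _ hd)
    simp only [Pi.zero_apply]
    linarith
  intro t ht
  have hpos : 0 < 1 + Δ₁ := by linarith
  have hlower : Real.exp (s * t) * ((1 + Δ₁) * (f (X t) - f xs)) ≤ E 0 := by
    refine le_trans ?_ (hanti ht)
    rw [hE t]
    gcongr
    exact le_add_of_nonneg_right (by positivity)
  calc f (X t) - f xs
      = 1 / (1 + Δ₁) * Real.exp (-(s * t)) *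
          (Real.exp (s * t) * ((1 + Δ₁) * (f (X t) - f xs))) := by
        rw [Real.exp_neg]
        field_simp
    _ ≤ _ := by gcongr
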